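/- Let π be a node map between two graphs and let (f, σ) be a swap of π of size K ≥ 2. Then: (i) for every index i ∈ S with β i ≠ (none, none), the backward assignment β i is not an element of π ∖ F; and (ii) the map i ↦ β i is injective on the set {i ∈ S | β i ≠ (none, none)}. -/

import Mathlib

/-- A node map between two graphs with node sets `VG` and `VH`: a finite set of
assignments (pairs of optional nodes, `none` modelling the dummy symbol ε) such that
every node of `G` occurs as the first component of exactly one assignment, and every
node of `H` occurs as the second component of exactly one assignment. -/
def IsNodeMap {VG VH : Type*} (π : Finset (Option VG × Option VH)) : Prop :=
  (∀ u : VG, ∃! w : Option VH, (some u, w) ∈ π) ∧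
    (∀ v : VH, ∃! w : Option VG, (w, some v) ∈ π)

/-- A swap of size `K` of the node map `π`: an injective map `f` from a `K`-element
index type `S` into `π`, together with a permutation `σ` of `S` that is a single
`K`-cycle (its support is all of `S`). -/
def IsSwap {VG VH S : Type*} [Fintype S] [DecidableEq S]
    (π : Finset (Option VG × Option VH)) (f : S → Option VG × Option VH)
    (σ : Equiv.Perm S) (K : ℕ) : Prop :=
  Function.Injective f ∧ (∀ i : S, f i ∈ π) ∧ Fintype.card S = K ∧ 2 ≤ K ∧
    σ.IsCycle ∧ σ.support = Finset.univ

/-- The node map obtained from `π` by carrying out the swap `(f, σ)`: remove the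
forward assignments `F = f '' S` and add the backward assignments
`β i = ((f (σ i)).1, (f i).2)`, except for the dummy assignment `(none, none)`. -/
def SWAP {VG VH S : Type*} [DecidableEq VG] [DecidableEq VH] [Fintype S] [DecidableEq S]
    (π : Finset (Option VG × Option VH)) (f : S → Option VG × Option VH)
    (σ : Equiv.Perm S) : Finset (Option VG × Option VH) :=
  (π \ Finset.univ.image f) ∪
    (Finset.univ.filter fun i : S =>
        ((f (σ i)).1, (f i).2) ≠ ((none : Option VG), (none : Option VH))).image
      (fun i : S => ((f (σ i)).1, (f i).2))

/-- The number of node substitutions contained in a node map. -/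
def numSub {VG VH : Type*} [DecidableEq VG] [DecidableEq VH]
    (π : Finset (Option VG × Option VH)) : ℕ :=
  (π.filter fun p => p.1 ≠ none ∧ p.2 ≠ none).card

theorem IsNodeMap.eq_of_fst_eq {VG VH : Type*} {π : Finset (Option VG × Option VH)}
    (hπ : IsNodeMap π) {p q : Option VG × Option VH} (hp : p ∈ π) (hq : q ∈ π)
    (h : p.1 = q.1) (hne : p.1 ≠ none) : p = q := by
  obtain ⟨a, b⟩ := p
  obtain ⟨a', b'⟩ := q
  obtain rfl : a = a' := h
  obtain ⟨u, rfl⟩ := Option.ne_none_iff_exists'.mp hne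
  rw [(hπ.1 u).unique hp hq]

theorem IsNodeMap.eq_of_snd_eq {VG VH : Type*} {π : Finset (Option VG × Option VH)}
    (hπ : IsNodeMap π) {p q : Option VG × Option VH} (hp : p ∈ π) (hq : q ∈ π)
    (h : p.2 = q.2) (hne : p.2 ≠ none) : p = q := by
  obtain ⟨a, b⟩ := p
  obtain ⟨a', b'⟩ := q
  obtain rfl : b = b' := h
  obtain ⟨v, rfl⟩ := Option.ne_none_iff_exists'.mp hne
  rw [(hπ.2 v).unique hp hq]

/-- Let `π` be a node map and `(f, σ)` a swap of `π` of size `K ≥ 2`,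
with backward assignments `β i = ((f (σ i)).1, (f i).2)`. Then (i) every non-dummy
backward assignment `β i` lies outside `π \ F` (where `F` is the set of forward
assignments), and (ii) `β` is injective on the set of indices with non-dummy backward
assignment. -/
theorem swap_backward_disjoint_injective {VG VH S : Type*} [Fintype VG] [Fintype VH]
    [DecidableEq VG] [DecidableEq VH] [Fintype S] [DecidableEq S] (K : ℕ)
    (π : Finset (Option VG × Option VH)) (hπ : IsNodeMap π)
    (f : S → Option VG × Option VH) (σ : Equiv.Perm S)
    (hswap : IsSwap π f σ K) :
    (∀ i : S, ((f (σ i)).1, (f i).2) ≠ ((none : Option VG), (none : Option VH)) →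
      ((f (σ i)).1, (f i).2) ∉ π \ Finset.univ.image f) ∧
    (∀ i j : S, ((f (σ i)).1, (f i).2) ≠ ((none : Option VG), (none : Option VH)) →
      ((f (σ j)).1, (f j).2) ≠ ((none : Option VG), (none : Option VH)) →
      ((f (σ i)).1, (f i).2) = ((f (σ j)).1, (f j).2) → i = j) := by
  obtain ⟨hinj, hmem, -⟩ := hswap
  refine ⟨fun i hne hi => ?_, fun i j hne _ hij => ?_⟩
  · obtain ⟨hβ, hF⟩ := Finset.mem_sdiff.mp hi
    by_cases h : (f (σ i)).1 = none
    · refine hF (Finset.mem_image.mpr ⟨i, Finset.mem_univ i, ?_⟩)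
      exact (hπ.eq_of_snd_eq hβ (hmem i) rfl fun h' => hne (Prod.ext h h')).symm
    · refine hF (Finset.mem_image.mpr ⟨σ i, Finset.mem_univ _, ?_⟩)
      exact (hπ.eq_of_fst_eq hβ (hmem (σ i)) rfl h).symm
  · obtain ⟨h₁, h₂⟩ := Prod.mk.inj hij
    by_cases h : (f (σ i)).1 = none
    · exact hinj (hπ.eq_of_snd_eq (hmem i) (hmem j) h₂ fun h' => hne (Prod.ext h h'))
    · exact σ.injective (hinj (hπ.eq_of_fst_eq (hmem (σ i)) (hmem (σ j)) h₁ h))
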